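/- There exist absolute constants γ⋆ > 0 and δ⋆ > 0 such that for every γ > γ⋆ there is no unidirectional Stokes wave solution (ψ, η, r) with r < γ + √(2/γ) whose surface vertical velocity satisfies min over x ∈ ℝ of ψ_y(x, η(x)) = √(2γ) − δ⋆/γ (i.e. ψ_y(x, η(x)) ≥ √(2γ) − δ⋆/γ for all x, with equality attained at some x₀). -/

import Mathlib

noncomputable section

open Real Set

/-- Partial derivative of `ψ` in the horizontal variable. -/
def px (ψ : ℝ → ℝ → ℝ) (x y : ℝ) : ℝ := deriv (fun t => ψ t y) x

/-- Partial derivative of `ψ` in the vertical variable. -/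
def py (ψ : ℝ → ℝ → ℝ) (x y : ℝ) : ℝ := deriv (fun t => ψ x t) y

/-- Second partial derivative in `x`. -/
def pxx (ψ : ℝ → ℝ → ℝ) (x y : ℝ) : ℝ := deriv (fun t => px ψ t y) x

/-- Second partial derivative in `y`. -/
def pyy (ψ : ℝ → ℝ → ℝ) (x y : ℝ) : ℝ := deriv (fun t => py ψ x t) y

/-- Depth `d(s)` of the laminar (stream) flow with surface value `s` of `ψ_y`. -/
def lamDepth (γ s : ℝ) : ℝ := (-s + Real.sqrt (s ^ 2 + 2 * γ)) / γ

/-- Bernoulli constant `R(s) = ½ s² + γ + d(s)` of the laminar flow. -/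
def bernR (γ s : ℝ) : ℝ := s ^ 2 / 2 + γ + lamDepth γ s

/-- `s` is the (unique) positive critical point `s_c` of `R`, characterized by the
equation `s - 1/γ + s/(γ √(s² + 2γ)) = 0`. -/
def IsCrit (γ s : ℝ) : Prop :=
  0 < s ∧ s - 1 / γ + s / (γ * Real.sqrt (s ^ 2 + 2 * γ)) = 0

/-- A solution `(ψ, η, r)` of the stream-function formulation with constant adverse
vorticity `ω = -γ`:  `Δψ = γ` in the fluid domain `D_η`, the Bernoulli condition on the
surface, `ψ = 1` on the surface and `ψ = 0` on the flat bottom. -/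
structure StreamSolution (γ : ℝ) (ψ : ℝ → ℝ → ℝ) (η : ℝ → ℝ) (r : ℝ) : Prop where
  eta_smooth : ContDiff ℝ (⊤ : ℕ∞) η
  eta_pos : ∀ x, 0 < η x
  psi_smooth : ContDiff ℝ (⊤ : ℕ∞) (fun p : ℝ × ℝ => ψ p.1 p.2)
  laplace : ∀ x y, 0 < y → y < η x → pxx ψ x y + pyy ψ x y = γ
  bernoulli : ∀ x, (px ψ x (η x)) ^ 2 / 2 + (py ψ x (η x)) ^ 2 / 2 + η x = r
  surface_val : ∀ x, ψ x (η x) = 1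
  bottom_val : ∀ x, ψ x 0 = 0

/-- The flow is unidirectional: `ψ_y > 0` everywhere in the fluid domain `D_η`. -/
def Unidirectional (ψ : ℝ → ℝ → ℝ) (η : ℝ → ℝ) : Prop :=
  ∀ x y, 0 < y → y < η x → 0 < py ψ x y

/-- A Stokes wave with half-period `Λ`: the solution is `2Λ`-periodic and even in `x`,
and the surface profile is strictly decreasing from the crest (`x = 0`) to the
trough (`x = Λ`).  Thus `η̂ = max η = η 0` and `η̌ = min η = η Λ`. -/
structure StokesWave (γ : ℝ) (ψ : ℝ → ℝ → ℝ) (η : ℝ → ℝ) (r Λ : ℝ) : Prop where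
  sol : StreamSolution γ ψ η r
  lam_pos : 0 < Λ
  eta_periodic : ∀ x, η (x + 2 * Λ) = η x
  eta_even : ∀ x, η (-x) = η x
  psi_periodic : ∀ x y, ψ (x + 2 * Λ) y = ψ x y
  psi_even : ∀ x y, ψ (-x) y = ψ x y
  eta_anti : StrictAntiOn η (Set.Icc 0 Λ)

/-- A solitary wave (relative to the critical value `sc = s_c` of `γ`): the solution is
even in `x`, the profile is strictly decreasing on `(0, ∞)` and non-constant, and the
flow converges to a supercritical laminar flow `(U(·; s), d(s))` with `s > s_c`,
`R(s) = r` as `|x| → ∞`.  The crest is at `x = 0`, `η̂ = η 0` and `η̌ = inf η = d(s)`. -/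
structure SolitaryWave (γ sc : ℝ) (ψ : ℝ → ℝ → ℝ) (η : ℝ → ℝ) (r : ℝ) : Prop where
  sol : StreamSolution γ ψ η r
  eta_even : ∀ x, η (-x) = η x
  psi_even : ∀ x y, ψ (-x) y = ψ x y
  eta_anti : StrictAntiOn η (Set.Ioi 0)
  nonconst : ∃ x₁ x₂, η x₁ ≠ η x₂
  asymptotic : ∃ s, sc < s ∧ bernR γ s = r ∧
    ∀ ε > 0, ∃ X : ℝ, ∀ x : ℝ, X ≤ |x| →
      |η x - lamDepth γ s| ≤ ε ∧
      ∀ y ∈ Set.Icc 0 (η x), |px ψ x y| + |py ψ x y - (γ * y + s)| ≤ ε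


structure C2 (f fx fy fxx fyy : ℝ × ℝ → ℝ) : Prop where
  hx : ∀ x y, HasDerivAt (fun t => f (t, y)) (fx (x, y)) x
  hy : ∀ x y, HasDerivAt (fun t => f (x, t)) (fy (x, y)) y
  hxx : ∀ x y, HasDerivAt (fun t => fx (t, y)) (fxx (x, y)) x
  hyy : ∀ x y, HasDerivAt (fun t => fy (x, t)) (fyy (x, y)) y

theorem C2.add {f fx fy fxx fyy g gx gy gxx gyy : ℝ × ℝ → ℝ}
    (hf : C2 f fx fy fxx fyy) (hg : C2 g gx gy gxx gyy) :
    C2 (fun p => f p + g p) (fun p => fx p + gx p) (fun p => fy p + gy p)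
      (fun p => fxx p + gxx p) (fun p => fyy p + gyy p) :=
  ⟨fun x y => (hf.hx x y).add (hg.hx x y), fun x y => (hf.hy x y).add (hg.hy x y),
    fun x y => (hf.hxx x y).add (hg.hxx x y), fun x y => (hf.hyy x y).add (hg.hyy x y)⟩

theorem C2.smul {f fx fy fxx fyy : ℝ × ℝ → ℝ} (c : ℝ)
    (hf : C2 f fx fy fxx fyy) :
    C2 (fun p => c * f p) (fun p => c * fx p) (fun p => c * fy p)
      (fun p => c * fxx p) (fun p => c * fyy p) :=
  ⟨fun x y => (hf.hx x y).const_mul c, fun x y => (hf.hy x y).const_mul c,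
    fun x y => (hf.hxx x y).const_mul c, fun x y => (hf.hyy x y).const_mul c⟩

theorem C2.mul {f fx fy fxx fyy g gx gy gxx gyy : ℝ × ℝ → ℝ}
    (hf : C2 f fx fy fxx fyy) (hg : C2 g gx gy gxx gyy) :
    C2 (fun p => f p * g p) (fun p => fx p * g p + f p * gx p) (fun p => fy p * g p + f p * gy p)
      (fun p => fxx p * g p + 2 * (fx p * gx p) + f p * gxx p)
      (fun p => fyy p * g p + 2 * (fy p * gy p) + f p * gyy p) := by
  refine ⟨fun x y => (hf.hx x y).mul (hg.hx x y), fun x y => (hf.hy x y).mul (hg.hy x y),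
    fun x y => ?_, fun x y => ?_⟩
  · exact (((hf.hxx x y).mul (hg.hx x y)).add ((hf.hx x y).mul (hg.hxx x y))).congr_deriv (by ring)
  · exact (((hf.hyy x y).mul (hg.hy x y)).add ((hf.hy x y).mul (hg.hyy x y))).congr_deriv (by ring)

theorem C2.ofY (c d : ℝ) :
    C2 (fun p => c + d * p.2) (fun _ => 0) (fun _ => d) (fun _ => 0) (fun _ => 0) := by
  refine ⟨fun x y => hasDerivAt_const x (c + d * y), fun x y => ?_, fun x y => hasDerivAt_const _ _,
    fun x y => hasDerivAt_const _ _⟩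
  simpa using ((hasDerivAt_id y).const_mul d).const_add c

theorem second_deriv_nonpos {f f' : ℝ → ℝ} {c a : ℝ} (hf : ∀ x, HasDerivAt f (f' x) x)
    (hf' : HasDerivAt f' c a) (hm : IsLocalMax f a) : c ≤ 0 := by
  by_contra hc
  push Not at hc
  have hd : deriv f = f' := funext fun x => (hf x).deriv
  have hmin : IsLocalMin f a := by
    apply isLocalMin_of_deriv_deriv_pos
    · rw [hd, hf'.deriv]; exact hc
    · exact hm.deriv_eq_zero
    · exact (hf a).continuousAt
  have hE : ∀ᶠ x in nhds a, f x = f a := by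
    filter_upwards [hm, hmin] with x h1 h2 using le_antisymm h1 h2
  have hE2 : ∀ᶠ x in nhds a, f' x = 0 := by
    filter_upwards [hE.eventually_nhds] with x hx
    have : HasDerivAt f 0 x := (hasDerivAt_const x (f a)).congr_of_eventuallyEq hx
    exact (hf x).unique this
  have : HasDerivAt f' 0 a := (hasDerivAt_const a (0:ℝ)).congr_of_eventuallyEq hE2
  have := hf'.unique this
  linarith

theorem maxp {f fx fy fxx fyy : ℝ × ℝ → ℝ} (hf : C2 f fx fy fxx fyy) (hc : Continuous f)
    {T : ℝ} (hT : 0 < T) (per : ∀ x y, f (x + T, y) = f (x, y))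
    {η : ℝ → ℝ} (hη : Continuous η) (ηper : ∀ x, η (x + T) = η x) {a M : ℝ}
    (ha : ∀ x, a ≤ η x)
    (sub : ∀ x y, a < y → y < η x → 0 ≤ fxx (x, y) + fyy (x, y))
    (bot : ∀ x, f (x, a) ≤ M) (top : ∀ x, f (x, η x) ≤ M) :
    ∀ x y, a ≤ y → y ≤ η x → f (x, y) ≤ M := by
  have red : ∀ x, ∃ z ∈ Ico 0 T, η x = η z ∧ ∀ y, f (x, y) = f (z, y) := by
    intro x
    have hp : Function.Periodic (fun x => (η x, fun y => f (x, y))) T := by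
      intro x
      simp only [ηper, per]
    obtain ⟨z, hz, h⟩ := hp.exists_mem_Ico₀ hT x
    simp only [Prod.mk.injEq] at h
    exact ⟨z, hz, h.1, fun y => congrFun h.2 y⟩
  obtain ⟨K, hK⟩ : ∃ K, ∀ x ∈ Icc 0 T, η x ≤ K := by
    obtain ⟨z, _, hz⟩ := isCompact_Icc.exists_isMaxOn (nonempty_Icc.2 hT.le) hη.continuousOn
    exact ⟨η z, fun x hx => hz hx⟩
  have key : ∀ e > 0, ∀ x y, a ≤ y → y ≤ η x → f (x, y) ≤ M + e * (K - a) ^ 2 := by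
    intro e he
    set S : Set (ℝ × ℝ) := {p | p.1 ∈ Icc 0 T ∧ a ≤ p.2 ∧ p.2 ≤ η p.1} with hS
    have hScl : IsClosed S := by
      apply IsClosed.and
      · exact isClosed_Icc.preimage continuous_fst
      apply IsClosed.and
      · exact isClosed_le continuous_const continuous_snd
      · exact isClosed_le continuous_snd (hη.comp continuous_fst)
    have hScomp : IsCompact S := by
      apply (isCompact_Icc.prod isCompact_Icc : IsCompact (Icc 0 T ×ˢ Icc a K)).of_isClosed_subset hScl
      rintro ⟨x, y⟩ ⟨h1, h2, h3⟩
      exact ⟨h1, h2, h3.trans (hK _ h1)⟩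
    have hSne : S.Nonempty := ⟨(0, a), ⟨⟨le_rfl, hT.le⟩, le_rfl, ha 0⟩⟩
    have hg : Continuous (fun p : ℝ × ℝ => f p + e * (p.2 - a) ^ 2) := by fun_prop
    obtain ⟨⟨X, Y⟩, ⟨hX, hY1, hY2⟩, hmax⟩ := hScomp.exists_isMaxOn hSne hg.continuousOn
    simp only at hX hY1 hY2
    have gmax : ∀ x y, a ≤ y → y ≤ η x →
        f (x, y) + e * (y - a) ^ 2 ≤ f (X, Y) + e * (Y - a) ^ 2 := by
      intro x y h1 h2
      obtain ⟨z, hz, hz1, hz2⟩ := red x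
      rw [hz2 y]
      exact hmax (a := (z, y)) ⟨⟨hz.1, hz.2.le⟩, h1, hz1 ▸ h2⟩
    suffices f (X, Y) ≤ M by
      intro x y h1 h2
      have := gmax x y h1 h2
      have hYK : Y ≤ K := hY2.trans (hK _ hX)
      have h3 : (Y - a) ^ 2 ≤ (K - a) ^ 2 := by
        apply pow_le_pow_left₀ <;> linarith
      have h4 : 0 ≤ e * (y - a) ^ 2 := by positivity
      nlinarith
    rcases eq_or_lt_of_le hY1 with h | hlo
    · rw [← h]; exact bot X
    rcases eq_or_lt_of_le hY2 with h | hhi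
    · rw [h]; exact top X
    exfalso
    have c1 : fxx (X, Y) ≤ 0 := by
      refine second_deriv_nonpos (fun x => hf.hx x Y) (hf.hxx X Y) ?_
      have : ∀ᶠ t in nhds X, Y < η t := hη.continuousAt.eventually_const_lt hhi
      filter_upwards [this] with t ht
      have := gmax t Y hY1 ht.le
      linarith
    have c2 : fyy (X, Y) + 2 * e ≤ 0 := by
      refine second_deriv_nonpos (f := fun t => f (X, t) + e * (t - a) ^ 2)
        (f' := fun t => fy (X, t) + 2 * e * (t - a)) (a := Y) (fun y => ?_) ?_ ?_
      · refine (hf.hy X y).add ?_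
        have := (((hasDerivAt_id y).sub_const a).pow 2).const_mul e
        refine this.congr_deriv ?_
        simp only [id, Nat.cast_ofNat, Nat.add_one_sub_one, pow_one, mul_one]; ring
      · refine (hf.hyy X Y).add ?_
        simpa using ((hasDerivAt_id Y).sub_const a).const_mul (2 * e)
      · filter_upwards [Ioo_mem_nhds hlo hhi] with t ht
        exact gmax X t ht.1.le ht.2.le
    have := sub X Y hlo hhi
    linarith
  intro x y h1 h2
  by_contra hcon
  push Not at hcon
  have hpos : 0 < f (x, y) - M := by linarith
  have hK2 : 0 < (K - a) ^ 2 + 1 := by positivity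
  have := key ((f (x, y) - M) / ((K - a) ^ 2 + 1)) (by positivity) x y h1 h2
  have h3 : (f (x, y) - M) / ((K - a) ^ 2 + 1) * (K - a) ^ 2 < f (x, y) - M := by
    rw [div_mul_eq_mul_div, div_lt_iff₀ hK2]
    nlinarith
  linarith

def Dx (f : ℝ × ℝ → ℝ) (p : ℝ × ℝ) : ℝ := fderiv ℝ f p (1, 0)
def Dy (f : ℝ × ℝ → ℝ) (p : ℝ × ℝ) : ℝ := fderiv ℝ f p (0, 1)

abbrev Smooth (f : ℝ × ℝ → ℝ) : Prop := ContDiff ℝ (⊤ : ℕ∞) f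

theorem Smooth.dx {f : ℝ × ℝ → ℝ} (hf : Smooth f) : Smooth (Dx f) := by
  have : ContDiff ℝ (⊤ : ℕ∞) (fderiv ℝ f) := hf.fderiv_right (by simp)
  exact this.clm_apply contDiff_const

theorem Smooth.dy {f : ℝ × ℝ → ℝ} (hf : Smooth f) : Smooth (Dy f) := by
  have : ContDiff ℝ (⊤ : ℕ∞) (fderiv ℝ f) := hf.fderiv_right (by simp)
  exact this.clm_apply contDiff_const

theorem Smooth.diff {f : ℝ × ℝ → ℝ} (hf : Smooth f) : Differentiable ℝ f :=
  hf.differentiable (by simp)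

/-- chain rule along a curve -/
theorem Smooth.curve {f : ℝ × ℝ → ℝ} (hf : Smooth f) {a b : ℝ → ℝ} {a' b' t : ℝ}
    (ha : HasDerivAt a a' t) (hb : HasDerivAt b b' t) :
    HasDerivAt (fun s => f (a s, b s)) (a' * Dx f (a t, b t) + b' * Dy f (a t, b t)) t := by
  have h := (hf.diff (a t, b t)).hasFDerivAt.comp_hasDerivAt t (ha.prodMk hb)
  refine h.congr_deriv ?_
  have : ((a', b') : ℝ × ℝ) = a' • (1, 0) + b' • (0, 1) := by simp
  rw [this, map_add, map_smul, map_smul]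
  rfl

theorem Smooth.hasx {f : ℝ × ℝ → ℝ} (hf : Smooth f) (x y : ℝ) :
    HasDerivAt (fun t => f (t, y)) (Dx f (x, y)) x := by
  simpa using hf.curve (hasDerivAt_id x) (hasDerivAt_const x y)

theorem Smooth.hasy {f : ℝ × ℝ → ℝ} (hf : Smooth f) (x y : ℝ) :
    HasDerivAt (fun t => f (x, t)) (Dy f (x, y)) y := by
  simpa using hf.curve (hasDerivAt_const y x) (hasDerivAt_id y)

theorem Smooth.C2 {f : ℝ × ℝ → ℝ} (hf : Smooth f) :
    C2 f (Dx f) (Dy f) (Dx (Dx f)) (Dy (Dy f)) :=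
  ⟨hf.hasx, hf.hasy, hf.dx.hasx, hf.dy.hasy⟩

theorem Smooth.comm {f : ℝ × ℝ → ℝ} (hf : Smooth f) (p : ℝ × ℝ) :
    Dx (Dy f) p = Dy (Dx f) p := by
  have hs : IsSymmSndFDerivAt ℝ f p :=
    (hf.contDiffAt (x := p)).isSymmSndFDerivAt (by
      simp only [minSmoothness_of_isRCLikeNormedField]
      exact WithTop.coe_le_coe.2 (le_top (a := (2 : ℕ∞))))
  have hd : DifferentiableAt ℝ (fderiv ℝ f) p :=
    ((hf.fderiv_right (m := (⊤ : ℕ∞)) (by simp)).differentiable (by simp)) p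
  have e : ∀ v w : ℝ × ℝ, fderiv ℝ (fun q => fderiv ℝ f q v) p w = fderiv ℝ (fderiv ℝ f) p w v := by
    intro v w
    rw [fderiv_clm_apply hd (differentiableAt_const v)]
    simp
  unfold Dx Dy
  rw [e, e]
  exact hs _ _

theorem lap_dx {f : ℝ × ℝ → ℝ} (hf : Smooth f) {U : Set (ℝ × ℝ)} (hU : IsOpen U) {c : ℝ}
    (h : ∀ p ∈ U, Dx (Dx f) p + Dy (Dy f) p = c) :
    ∀ p ∈ U, Dx (Dx (Dx f)) p + Dy (Dy (Dx f)) p = 0 := by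
  intro p hp
  have e : (fun q => Dx (Dx f) q + Dy (Dy f) q) =ᶠ[nhds p] fun _ => c :=
    Filter.eventually_of_mem (hU.mem_nhds hp) h
  have e1 := e.fderiv_eq (𝕜 := ℝ)
  rw [fderiv_fun_add (hf.dx.dx.diff p) (hf.dy.dy.diff p)] at e1
  have e2 := congrArg (fun L : ℝ × ℝ →L[ℝ] ℝ => L (1, 0)) e1
  simp at e2
  have c1 : Dy (Dx f) = Dx (Dy f) := funext fun q => (hf.comm q).symm
  have c2 := hf.dy.comm p
  rw [c1, ← c2]
  exact e2

theorem lap_dy {f : ℝ × ℝ → ℝ} (hf : Smooth f) {U : Set (ℝ × ℝ)} (hU : IsOpen U) {c : ℝ}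
    (h : ∀ p ∈ U, Dx (Dx f) p + Dy (Dy f) p = c) :
    ∀ p ∈ U, Dx (Dx (Dy f)) p + Dy (Dy (Dy f)) p = 0 := by
  intro p hp
  have e : (fun q => Dx (Dx f) q + Dy (Dy f) q) =ᶠ[nhds p] fun _ => c :=
    Filter.eventually_of_mem (hU.mem_nhds hp) h
  have e1 := e.fderiv_eq (𝕜 := ℝ)
  rw [fderiv_fun_add (hf.dx.dx.diff p) (hf.dy.dy.diff p)] at e1
  have e2 := congrArg (fun L : ℝ × ℝ →L[ℝ] ℝ => L (0, 1)) e1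
  simp at e2
  have c1 : Dx (Dy f) = Dy (Dx f) := funext fun q => hf.comm q
  have c2 := hf.dx.comm p
  rw [c1, c2]
  exact e2

/-- one-sided: `k ≤ 0` on `[a,b]`, `k b = 0` gives `k' b ≥ 0`. -/
theorem deriv_end {k : ℝ → ℝ} {k' a b : ℝ} (hab : a < b) (hk : HasDerivAt k k' b)
    (h0 : k b = 0) (hle : ∀ y ∈ Icc a b, k y ≤ 0) : 0 ≤ k' := by
  have h := hk.hasDerivWithinAt (s := Iic b)
  by_contra hn
  push Not at hn
  have h1 := hk.tendsto_slope
  have h2 : ∀ᶠ y in nhdsWithin b {b}ᶜ, slope k b y < 0 := h1.eventually_lt_const hn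
  have h3 : ∀ᶠ y in nhdsWithin b (Iio b), slope k b y < 0 :=
    h2.filter_mono (nhdsWithin_mono _ (fun y hy => ne_of_lt hy))
  have h4 : ∀ᶠ y in nhdsWithin b (Iio b), y ∈ Ioo a b := Ioo_mem_nhdsLT hab
  obtain ⟨y, hy1, hy2⟩ := (h3.and h4).exists
  have h5 := hle y ⟨hy2.1.le, hy2.2.le⟩
  rw [slope_def_field, h0, sub_zero] at hy1
  have : 0 ≤ k y / (y - b) := div_nonneg_of_nonpos h5 (by linarith [hy2.2])
  linarith

structure Core (ε μ T x₀ : ℝ) (f : ℝ × ℝ → ℝ) (η : ℝ → ℝ) : Prop where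
  eps_pos : 0 < ε
  eps_le : ε ≤ 1 / 1000000
  mu_lt : μ < 1
  T_pos : 0 < T
  f_smooth : Smooth f
  eta_diff : Differentiable ℝ η
  eta_pos : ∀ x, 0 < η x
  f_per : ∀ x y, f (x + T, y) = f (x, y)
  eta_per : ∀ x, η (x + T) = η x
  lap : ∀ p ∈ {p : ℝ × ℝ | 0 < p.2 ∧ p.2 < η p.1}, Dx (Dx f) p + Dy (Dy f) p = 2
  bern : ∀ x, Dx f (x, η x) ^ 2 + Dy f (x, η x) ^ 2 = 4 + 2 * ε * (μ - η x)
  top : ∀ x, f (x, η x) = 1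
  bot : ∀ x, f (x, 0) = 0
  uni : ∀ x y, 0 < y → y < η x → 0 < Dy f (x, y)
  ge : ∀ x, 2 - ε ≤ Dy f (x, η x)
  eq : Dy f (x₀, η x₀) = 2 - ε
  sgn : 0 ≤ Dx f (x₀, η x₀)

namespace Core

variable {ε μ T x₀ : ℝ} {f : ℝ × ℝ → ℝ} {η : ℝ → ℝ}

theorem eta_cont (h : Core ε μ T x₀ f η) : Continuous η := h.eta_diff.continuous

theorem isOpen_dom (h : Core ε μ T x₀ f η) : IsOpen {p : ℝ × ℝ | 0 < p.2 ∧ p.2 < η p.1} :=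
  (isOpen_lt continuous_const continuous_snd).and
    (isOpen_lt continuous_snd (h.eta_cont.comp continuous_fst))

theorem dx_per (h : Core ε μ T x₀ f η) (x y : ℝ) : Dx f (x + T, y) = Dx f (x, y) := by
  have h1 := (h.f_smooth.hasx (x + T) y).comp_add_const x T
  have h2 := h.f_smooth.hasx x y
  simp only [h.f_per] at h1
  exact h1.unique h2

theorem dy_per (h : Core ε μ T x₀ f η) (x y : ℝ) : Dy f (x + T, y) = Dy f (x, y) := by
  have h1 := h.f_smooth.hasy (x + T) y
  have h2 := h.f_smooth.hasy x y
  simp only [h.f_per] at h1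
  exact h1.unique h2

theorem eta_lt (h : Core ε μ T x₀ f η) (x : ℝ) : η x < 3 := by
  have h1 := h.bern x
  have h2 := h.ge x
  have h3 := h.eps_pos
  have h4 := h.eps_le
  have h5 := h.mu_lt
  have : (2 - ε) ^ 2 ≤ Dy f (x, η x) ^ 2 := pow_le_pow_left₀ (by linarith) h2 2
  have h6 : 0 ≤ ε * (2 * (μ - η x) + 4 - ε) := by nlinarith [sq_nonneg (Dx f (x, η x))]
  have h7 := nonneg_of_mul_nonneg_right h6 h3
  linarith

theorem bot_dy (h : Core ε μ T x₀ f η) (x : ℝ) : 0 ≤ Dy f (x, 0) := by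
  have hc : Continuous (fun t => Dy f (x, t)) := h.f_smooth.dy.continuous.comp (by fun_prop)
  have ht : Filter.Tendsto (fun t => Dy f (x, t)) (nhdsWithin 0 (Ioi 0)) (nhds (Dy f (x, 0))) :=
    hc.continuousAt.tendsto.mono_left nhdsWithin_le_nhds
  refine ge_of_tendsto ht ?_
  filter_upwards [Ioo_mem_nhdsGT (h.eta_pos x)] with t ht
  exact (h.uni x t ht.1 ht.2).le

theorem top_lap (h : Core ε μ T x₀ f η) (x : ℝ) :
    Dx (Dx f) (x, η x) + Dy (Dy f) (x, η x) = 2 := by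
  have hc : Continuous (fun t => Dx (Dx f) (x, t) + Dy (Dy f) (x, t)) :=
    (h.f_smooth.dx.dx.continuous.comp (by fun_prop)).add
      (h.f_smooth.dy.dy.continuous.comp (by fun_prop))
  have ht := (hc.continuousAt (x := η x)).tendsto.mono_left
    (nhdsWithin_le_nhds (s := Iio (η x)))
  refine tendsto_nhds_unique (ht.congr' ?_) tendsto_const_nhds
  filter_upwards [Ioo_mem_nhdsLT (h.eta_pos x)] with t ht
  exact h.lap (x, t) ht

/-- `u = f - y²` with its derivatives. -/
theorem C2u (h : Core ε μ T x₀ f η) :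
    C2 (fun p => f p + (-1) * ((0 + 1 * p.2) * (0 + 1 * p.2))) (fun p => Dx f p)
      (fun p => Dy f p - 2 * p.2) (fun p => Dx (Dx f) p) (fun p => Dy (Dy f) p - 2) := by
  have := h.f_smooth.C2.add (((C2.ofY 0 1).mul (C2.ofY 0 1)).smul (-1))
  convert this using 2 <;> simp
  · ring
  · ring

/-- `u_y - u ≥ -ε` -/
theorem v_ge (h : Core ε μ T x₀ f η) (x y : ℝ) (h0 : 0 ≤ y) (h1 : y ≤ η x) :
    f (x, y) - y ^ 2 - ε ≤ Dy f (x, y) - 2 * y := by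
  have hC := h.C2u.add (((h.f_smooth.dy.C2).add ((C2.ofY 0 (-2)))).smul (-1))
  have hc : Continuous f := h.f_smooth.continuous
  have hcy : Continuous (Dy f) := h.f_smooth.dy.continuous
  have := maxp hC (M := ε) (by fun_prop) h.T_pos (by intro x y; simp only [h.f_per, h.dy_per])
    h.eta_cont h.eta_per (fun x => (h.eta_pos x).le) ?_ ?_ ?_ x y h0 h1
  · simp only at this
    linarith
  · intro x y hy1 hy2
    have e1 := h.lap (x, y) ⟨hy1, hy2⟩
    have e2 := lap_dy h.f_smooth h.isOpen_dom h.lap (x, y) ⟨hy1, hy2⟩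
    linarith
  · intro x
    have := h.bot_dy x
    simp only [h.bot]
    linarith [h.eps_pos]
  · intro x
    have := h.ge x
    simp only [h.top]
    nlinarith [sq_nonneg (η x - 1)]

theorem u_ge' (h : Core ε μ T x₀ f η) (x y : ℝ) (h0 : 0 ≤ y) (h1 : y ≤ η x) :
    ε - ε * exp y ≤ f (x, y) - y ^ 2 := by
  have hd : ∀ t, HasDerivAt (fun t => exp (-t) * (f (x, t) - t ^ 2 - ε))
      (exp (-t) * ((Dy f (x, t) - 2 * t) - (f (x, t) - t ^ 2 - ε))) t := by
    intro t
    have a1 : HasDerivAt (fun t : ℝ => exp (-t)) (-exp (-t)) t := by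
      simpa using (hasDerivAt_neg t).exp
    have a2 : HasDerivAt (fun t => f (x, t) - t ^ 2 - ε) (Dy f (x, t) - 2 * t) t := by
      have := ((h.f_smooth.hasy x t).sub (hasDerivAt_pow 2 t)).sub_const ε
      simpa using this
    exact (a1.mul a2).congr_deriv (by ring)
  have hmono : MonotoneOn (fun t => exp (-t) * (f (x, t) - t ^ 2 - ε)) (Icc 0 (η x)) := by
    apply monotoneOn_of_deriv_nonneg (convex_Icc _ _)
    · exact fun t _ => (hd t).continuousAt.continuousWithinAt
    · exact fun t _ => (hd t).differentiableAt.differentiableWithinAt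
    · intro t ht
      rw [interior_Icc] at ht
      rw [(hd t).deriv]
      have := h.v_ge x t ht.1.le ht.2.le
      exact mul_nonneg (exp_pos _).le (by linarith)
  have := hmono ⟨le_rfl, h0.trans h1⟩ ⟨h0, h1⟩ h0
  simp only [h.bot, neg_zero, exp_zero] at this
  have e : exp y * exp (-y) = 1 := by rw [← exp_add]; simp
  have := mul_le_mul_of_nonneg_left this (exp_pos y).le
  have e' : exp y * (exp (-y) * (f (x, y) - y ^ 2 - ε)) = f (x, y) - y ^ 2 - ε := by
    rw [← mul_assoc, e, one_mul]
  rw [e'] at this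
  linarith

theorem u_ge (h : Core ε μ T x₀ f η) (x y : ℝ) (h0 : 0 ≤ y) (h1 : y ≤ η x) :
    - 20 * ε ≤ f (x, y) - y ^ 2 := by
  have a := h.u_ge' x y h0 h1
  have b := h.eta_lt x
  have c : exp y ≤ exp 3 := exp_le_exp.2 (by linarith)
  have d : exp 3 ≤ 21 := by
    have e : exp 3 = exp 1 ^ 3 := by rw [← exp_nat_mul]; norm_num
    rw [e]
    have := exp_one_lt_d9
    calc exp 1 ^ 3 ≤ 2.7182818286 ^ 3 := pow_le_pow_left₀ (exp_pos 1).le this.le 3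
      _ ≤ 21 := by norm_num
  nlinarith [h.eps_pos]

theorem exists_min (h : Core ε μ T x₀ f η) : ∃ z, ∀ x, η z ≤ η x := by
  obtain ⟨z, _, hz⟩ := (isCompact_Icc (a := (0:ℝ)) (b := T)).exists_isMinOn
    (nonempty_Icc.2 h.T_pos.le) h.eta_cont.continuousOn
  refine ⟨z, fun x => ?_⟩
  have hp : Function.Periodic η T := h.eta_per
  obtain ⟨y, hy, e⟩ := hp.exists_mem_Ico₀ h.T_pos x
  rw [e]
  exact hz ⟨hy.1, hy.2.le⟩

theorem trough (h : Core ε μ T x₀ f η) : ∃ d, (∀ x, d ≤ η x) ∧ d ≤ μ ∧ 1 - ε / 2 ≤ d ∧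
    ∀ x y, 0 ≤ y → y ≤ η x → f (x, y) - y ^ 2 ≤ 2 * ε * y := by
  obtain ⟨z, hz⟩ := h.exists_min
  have hd := h.eta_pos z
  have hε := h.eps_pos
  have hε' := h.eps_le
  have hμ := h.mu_lt
  have hc : Continuous f := h.f_smooth.continuous
  have hu : ∀ x y, 0 ≤ y → y ≤ η x → f (x, y) - y ^ 2 - (1 / η z - η z) * y ≤ 0 := by
    intro x y h0 h1
    have hC := h.C2u.add (C2.ofY 0 (-(1 / η z - η z)))
    have := maxp hC (M := 0) (by fun_prop) h.T_pos (by intro x y; simp only [h.f_per])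
      h.eta_cont h.eta_per (fun x => (h.eta_pos x).le) ?_ ?_ ?_ x y h0 h1
    · simp only at this
      linarith
    · intro x y hy1 hy2
      have e1 := h.lap (x, y) ⟨hy1, hy2⟩
      linarith
    · intro x
      simp [h.bot]
    · intro x
      have e1 := hz x
      have e2 := h.eta_pos x
      have e3 : 1 / η x ≤ 1 / η z := one_div_le_one_div_of_le hd e1
      have e4 : 1 = (1 / η x) * η x := by field_simp
      simp only [h.top]
      nlinarith
  have hder : 0 ≤ Dy f (z, η z) - 2 * η z - (1 / η z - η z) := by
    have hk : HasDerivAt (fun y => f (z, y) - y ^ 2 - (1 / η z - η z) * y)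
        (Dy f (z, η z) - 2 * η z - (1 / η z - η z)) (η z) := by
      have := ((h.f_smooth.hasy z (η z)).sub (hasDerivAt_pow 2 (η z))).sub
        ((hasDerivAt_id (η z)).const_mul (1 / η z - η z))
      refine this.congr_deriv ?_
      simp
    refine deriv_end hd hk ?_ ?_
    · simp only [h.top]; field_simp; ring
    · intro y hy
      exact hu z y hy.1 hy.2
  set d := η z with hdd
  have hb := h.bern z
  rw [← hdd] at hb
  have i0 : 0 < 1 / d := by positivity
  have i1 : (1 / d + d) ^ 2 ≤ Dy f (z, d) ^ 2 := pow_le_pow_left₀ (by positivity) (by linarith) 2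
  have i2 : (1 / d) * d = 1 := by field_simp
  have i3 : (1 / d - d) ^ 2 ≤ 2 * ε * (μ - d) := by nlinarith [sq_nonneg (Dx f (z, d))]
  have i4 : 0 ≤ ε * (μ - d) := by nlinarith [sq_nonneg (1 / d - d)]
  have hdμ : d ≤ μ := by
    have := nonneg_of_mul_nonneg_right i4 hε
    linarith
  have hd1 : d < 1 := by linarith
  have i5 : 1 < 1 / d := by rw [lt_div_iff₀ hd]; linarith
  have i6 : 2 * (1 - d) ≤ 1 / d - d := by nlinarith [sq_nonneg (1 - d)]
  have i7 : (2 * (1 - d)) ^ 2 ≤ 2 * ε * (1 - d) := by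
    have : (2 * (1 - d)) ^ 2 ≤ (1 / d - d) ^ 2 := pow_le_pow_left₀ (by linarith) i6 2
    nlinarith
  have i8 : 1 - ε / 2 ≤ d := by
    have : 0 ≤ (1 - d) * (2 * ε - 4 * (1 - d)) := by nlinarith
    have := nonneg_of_mul_nonneg_right this (by linarith)
    linarith
  refine ⟨d, hz, hdμ, i8, fun x y h0 h1 => ?_⟩
  have i9 : 1 / d - d ≤ 2 * ε := by
    have : 1 / d ≤ 1 + ε := by
      rw [div_le_iff₀ hd]; nlinarith
    linarith
  have := hu x y h0 h1
  nlinarith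

theorem grad_mid (h : Core ε μ T x₀ f η) (x : ℝ) : Dx f (x, 3 / 4) ^ 2 ≤ 76800 * ε ^ 2 := by
  obtain ⟨d, hd1, hd2, hd3, hd4⟩ := h.trough
  have hε := h.eps_pos
  have hε' := h.eps_le
  have hu2 : ∀ x y, 0 ≤ y → y ≤ 7 / 8 → (f (x, y) - y ^ 2) ^ 2 ≤ 400 * ε ^ 2 := by
    intro x y h0 h1
    have hy : y ≤ η x := by linarith [hd1 x]
    have a := hd4 x y h0 hy
    have b := h.u_ge x y h0 hy
    have : f (x, y) - y ^ 2 ≤ 20 * ε := by nlinarith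
    nlinarith
  have hX := h.f_smooth.dx.C2
  have hZ := (C2.ofY (7 / 8) (-1)).mul hX
  have hC := (hZ.mul hZ).add ((h.C2u.mul h.C2u).smul 3)
  have hc : Continuous f := h.f_smooth.continuous
  have hcx : Continuous (Dx f) := h.f_smooth.dx.continuous
  have := maxp hC (M := 1200 * ε ^ 2) (by fun_prop) h.T_pos
    (by intro x y; simp only [h.f_per, h.dx_per])
    (η := fun _ => 7 / 8) continuous_const (fun _ => rfl) (a := 0) (fun x => by norm_num)
    ?_ ?_ ?_ x (3 / 4) (by norm_num) (by norm_num)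
  · simp only at this
    have e := sq_nonneg (f (x, 3 / 4) - (3 / 4) ^ 2)
    nlinarith
  · intro x y hy1 hy2
    have hyη : y < η x := by linarith [hd1 x]
    have e1 := h.lap (x, y) ⟨hy1, hyη⟩
    have e2 := lap_dx h.f_smooth h.isOpen_dom h.lap (x, y) ⟨hy1, hyη⟩
    simp only
    generalize Dx (Dx (Dx f)) (x, y) = hxx at *
    generalize Dy (Dy (Dx f)) (x, y) = hyy at *
    generalize Dx (Dx f) (x, y) = hx at *
    generalize Dy (Dx f) (x, y) = hy at *
    generalize Dx f (x, y) = hh at *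
    generalize Dy f (x, y) = k at *
    generalize Dy (Dy f) (x, y) = uyy at *
    generalize f (x, y) = ff at *
    have e3 : uyy = 2 - hx := by linarith
    have e4 : hyy = - hxx := by linarith
    subst e3 e4
    have key : 0 ≤ 2 * ((7 / 8 - y) * hx) ^ 2 + 2 * ((7 / 8 - y) * hy - 2 * hh) ^ 2
      + 6 * (k - 2 * y) ^ 2 := by positivity
    refine key.trans (le_of_eq ?_)
    ring
  · intro x
    have e : Dx f (x, 0) = 0 := by
      have h1 := h.f_smooth.hasx x 0
      simp only [h.bot] at h1
      exact h1.unique (hasDerivAt_const x 0)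
    simp only [h.bot, e]
    nlinarith [sq_nonneg ε]
  · intro x
    have := hu2 x (7 / 8) (by norm_num) le_rfl
    simp only
    nlinarith

set_option maxHeartbeats 1000000 in
theorem false (h : Core ε μ T x₀ f η) : False := by
  obtain ⟨d, hd1, hd2, hd3, hd4⟩ := h.trough
  have hε := h.eps_pos
  have hε' := h.eps_le
  have hμ := h.mu_lt
  have hηle : ∀ x, η x ≤ 1 + 20 * ε := by
    intro x
    have := h.u_ge x (η x) (h.eta_pos x).le le_rfl
    rw [h.top] at this
    nlinarith [h.eta_pos x]
  set h₀ := Dx f (x₀, η x₀) with hh₀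
  have hb := h.bern x₀
  rw [h.eq, ← hh₀] at hb
  have hsq : 3 * ε ≤ h₀ ^ 2 := by nlinarith [hηle x₀]
  have hpos : 0 < h₀ := by
    rcases h.sgn.lt_or_eq with h1 | h1
    · exact h1
    · rw [← hh₀] at h1; rw [← h1] at hsq; nlinarith
  have hsq' : h₀ ^ 2 ≤ 1 := by nlinarith [hd1 x₀]
  -- derivative information at x₀
  have hη' : HasDerivAt η (deriv η x₀) x₀ := (h.eta_diff x₀).hasDerivAt
  set s := deriv η x₀ with hs
  have k1 : h₀ + s * (2 - ε) = 0 := by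
    have a := h.f_smooth.curve (hasDerivAt_id x₀) hη'
    simp only [id, h.top, h.eq, ← hh₀, one_mul] at a
    exact a.unique (hasDerivAt_const x₀ 1)
  have aY := h.f_smooth.dy.curve (hasDerivAt_id x₀) hη'
  have aX := h.f_smooth.dx.curve (hasDerivAt_id x₀) hη'
  simp only [id, one_mul] at aX aY
  have k2 : Dx (Dy f) (x₀, η x₀) + s * Dy (Dy f) (x₀, η x₀) = 0 := by
    have hm : IsLocalMin (fun t => Dy f (t, η t)) x₀ := by
      refine Filter.Eventually.of_forall fun t => ?_
      simp only
      rw [h.eq]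
      exact h.ge t
    exact hm.hasDerivAt_eq_zero aY
  rw [k2] at aY
  have k3 : h₀ * (Dx (Dx f) (x₀, η x₀) + s * Dy (Dx f) (x₀, η x₀)) = - ε * s := by
    have a := (aX.pow 2).add (aY.pow 2)
    have b : HasDerivAt (fun t => 4 + 2 * ε * (μ - η t)) (2 * ε * (-s)) x₀ :=
      ((hη'.const_sub μ).const_mul (2 * ε)).const_add 4
    have e : (fun t => 4 + 2 * ε * (μ - η t)) =
        ((fun s => Dx f (s, η s)) ^ 2 + (fun s => Dy f (s, η s)) ^ 2) :=
      funext fun t => (h.bern t).symm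
    rw [e] at b
    have := a.unique b
    simp only [Nat.cast_ofNat, Nat.add_one_sub_one, pow_one, mul_zero, add_zero] at this
    rw [← hh₀] at this
    linarith
  have k4 := h.top_lap x₀
  rw [h.f_smooth.comm] at k2
  have hXY : Dy (Dx f) (x₀, η x₀) * (2 - ε) ≤ 2 * h₀ := by
    generalize Dx (Dx f) (x₀, η x₀) = A at *
    generalize Dy (Dx f) (x₀, η x₀) = B at *
    generalize Dy (Dy f) (x₀, η x₀) = C at *
    have hB : B = - s * C := by linarith
    have hA : A = 2 - C := by linarith
    subst hB hA
    have hh : h₀ = - s * (2 - ε) := by linarith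
    have hs0 : 0 < - s := by
      by_contra hn
      push Not at hn
      nlinarith
    -- (2-ε)(2 - C - s² C) = ε
    have hq : (-s) * ((2 - ε) * (2 - C + s * (- s * C)) - ε) = 0 := by
      rw [hh] at k3; linarith
    have hq' : (2 - ε) * (2 - C + s * (- s * C)) - ε = 0 :=
      (mul_eq_zero.1 hq).resolve_left hs0.ne'
    have hC : C ≤ 2 := by
      by_contra hn
      push Not at hn
      have hX : 2 - C + s * (- s * C) < 0 := by nlinarith [mul_nonneg (sq_nonneg s) (by linarith : 0 ≤ C)]
      have := mul_neg_of_pos_of_neg (by linarith : 0 < 2 - ε) hX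
      linarith
    rw [hh]
    nlinarith
  -- barrier
  have hW : ∀ x y, 3 / 4 ≤ y → y ≤ η x →
      Dx f (x, y) ≤ h₀ + ε / h₀ * (η x₀ - y) - h₀ * ((1 - f (x, y)) + (1 - f (x, y)) ^ 2) := by
    intro x y h0 h1
    have ht := (C2.ofY 1 0).add (h.f_smooth.C2.smul (-1))
    have hC := (h.f_smooth.dx.C2.add ((C2.ofY (h₀ + ε / h₀ * η x₀) (-(ε / h₀))).smul (-1))).add
      ((ht.add (ht.mul ht)).smul h₀)
    have hc : Continuous f := h.f_smooth.continuous
    have hcx : Continuous (Dx f) := h.f_smooth.dx.continuous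
    have := maxp hC (M := 0) (by fun_prop) h.T_pos (by intro x y; simp only [h.f_per, h.dx_per])
      h.eta_cont h.eta_per (a := 3 / 4) (fun x => by linarith [hd1 x]) ?_ ?_ ?_ x y h0 h1
    · simp only at this
      linarith
    · intro x y hy1 hy2
      have e1 := h.lap (x, y) ⟨by linarith, hy2⟩
      have e2 := lap_dx h.f_smooth h.isOpen_dom h.lap (x, y) ⟨by linarith, hy2⟩
      have e3 := h.u_ge x y (by linarith) hy2.le
      have e4 := h.v_ge x y (by linarith) hy2.le
      simp only
      generalize Dx (Dx (Dx f)) (x, y) = hxx at *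
      generalize Dy (Dy (Dx f)) (x, y) = hyy at *
      generalize Dx (Dx f) (x, y) = hx at *
      generalize Dx f (x, y) = hh at *
      generalize Dy f (x, y) = k at *
      generalize Dy (Dy f) (x, y) = uyy at *
      generalize f (x, y) = ff at *
      have e5 : uyy = 2 - hx := by linarith
      have e6 : hyy = - hxx := by linarith
      subst e5 e6
      have e7 : 1.49 ≤ k := by nlinarith
      have e8 : 2.2 ≤ k ^ 2 := by nlinarith
      have e9 : 1 - ff ≤ 0.45 := by nlinarith
      have key : 0 ≤ h₀ * (2 * hh ^ 2 + 2 * k ^ 2 - 2 - 4 * (1 - ff)) :=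
        mul_nonneg hpos.le (by nlinarith [sq_nonneg hh])
      refine key.trans (le_of_eq ?_)
      ring
    · intro x
      have e1 := h.grad_mid x
      have e2 := h.u_ge x (3 / 4) (by norm_num) (by linarith [hd1 x])
      have e3 := hd4 x (3 / 4) (by norm_num) (by linarith [hd1 x])
      have e4 : 0 ≤ ε / h₀ * (η x₀ - 3 / 4) :=
        mul_nonneg (by positivity) (by linarith [hd1 x₀])
      have e5 : Dx f (x, 3 / 4) ≤ 0.3 * h₀ := by
        refine le_of_sq_le_sq ?_ (by positivity)
        nlinarith
      have e6 : (1 + -1 * f (x, 3 / 4)) + (1 + -1 * f (x, 3 / 4)) * (1 + -1 * f (x, 3 / 4)) ≤ 0.7 := by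
        nlinarith
      have e7 := mul_le_mul_of_nonneg_left e6 hpos.le
      simp only
      linarith
    · intro x
      have e1 := h.bern x
      have e2 := h.ge x
      have e3 : (2 - ε) ^ 2 ≤ Dy f (x, η x) ^ 2 := pow_le_pow_left₀ (by linarith) e2 2
      have e4 : Dx f (x, η x) ^ 2 ≤ h₀ ^ 2 + 2 * ε * (η x₀ - η x) := by linarith
      have e5 : h₀ * Dx f (x, η x) ≤ h₀ * (h₀ + ε / h₀ * (η x₀ - η x)) := by
        have : h₀ * (h₀ + ε / h₀ * (η x₀ - η x)) = h₀ ^ 2 + ε * (η x₀ - η x) := by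
          field_simp
        rw [this]
        nlinarith [sq_nonneg (Dx f (x, η x) - h₀)]
      have e6 := le_of_mul_le_mul_left e5 hpos
      simp only [h.top]
      linarith
  have hend : 0 ≤ Dy (Dx f) (x₀, η x₀) + ε / h₀ - h₀ * (2 - ε) := by
    have hk : HasDerivAt (fun y => Dx f (x₀, y) -
        (h₀ + ε / h₀ * (η x₀ - y) - h₀ * ((1 - f (x₀, y)) + (1 - f (x₀, y)) ^ 2)))
        (Dy (Dx f) (x₀, η x₀) + ε / h₀ - h₀ * (2 - ε)) (η x₀) := by
      have a1 := h.f_smooth.dx.hasy x₀ (η x₀)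
      have a2 := (h.f_smooth.hasy x₀ (η x₀)).const_sub 1
      have a3 := ((((hasDerivAt_id (η x₀)).const_sub (η x₀)).const_mul (ε / h₀)).const_add h₀).sub
        ((a2.add (a2.pow 2)).const_mul h₀)
      refine (a1.sub a3).congr_deriv ?_
      simp [h.top, h.eq]
      ring
    refine deriv_end (a := 3 / 4) (by linarith [hd1 x₀]) hk ?_ ?_
    · simp [h.top, ← hh₀]
    · intro y hy
      have := hW x₀ y hy.1 hy.2
      linarith
  have hq : ε / h₀ ≤ h₀ / 3 := by
    rw [div_le_iff₀ hpos]; nlinarith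
  have hεh : ε * h₀ ≤ 1 / 1000000 * h₀ := mul_le_mul_of_nonneg_right hε' hpos.le
  have hB : 1.6 * h₀ ≤ Dy (Dx f) (x₀, η x₀) := by linarith
  have hB2 : 1.6 * h₀ * (2 - ε) ≤ Dy (Dx f) (x₀, η x₀) * (2 - ε) :=
    mul_le_mul_of_nonneg_right hB (by linarith)
  linarith

end Core

/-- Rescaling of a function on the plane. -/
def scaleFn (k : ℝ) (G : ℝ × ℝ → ℝ) (p : ℝ × ℝ) : ℝ := G (k * p.1, k * p.2)

theorem scaleFn_smooth (k : ℝ) {G : ℝ × ℝ → ℝ} (hG : Smooth G) : Smooth (scaleFn k G) := by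
  unfold scaleFn
  have : ContDiff ℝ (⊤ : ℕ∞) (fun p : ℝ × ℝ => (k * p.1, k * p.2)) := by fun_prop
  exact ContDiff.comp hG this

theorem scaleFn_dx (k : ℝ) {G : ℝ × ℝ → ℝ} (hG : Smooth G) :
    Dx (scaleFn k G) = fun p => k * scaleFn k (Dx G) p := by
  funext ⟨x, y⟩
  have h1 := (scaleFn_smooth k hG).hasx x y
  have h2 := hG.curve ((hasDerivAt_id x).const_mul k) (hasDerivAt_const x (k * y))
  have := h1.unique h2
  simpa [scaleFn] using this

theorem scaleFn_dy (k : ℝ) {G : ℝ × ℝ → ℝ} (hG : Smooth G) :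
    Dy (scaleFn k G) = fun p => k * scaleFn k (Dy G) p := by
  funext ⟨x, y⟩
  have h1 := (scaleFn_smooth k hG).hasy x y
  have h2 := hG.curve (hasDerivAt_const y (k * x)) ((hasDerivAt_id y).const_mul k)
  have := h1.unique h2
  simpa [scaleFn] using this

theorem dx_const_mul (k : ℝ) {G : ℝ × ℝ → ℝ} (hG : Smooth G) (p : ℝ × ℝ) :
    Dx (fun p => k * G p) p = k * Dx G p := by
  unfold Dx
  rw [fderiv_const_mul (hG.diff p)]
  simp

theorem dy_const_mul (k : ℝ) {G : ℝ × ℝ → ℝ} (hG : Smooth G) (p : ℝ × ℝ) :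
    Dy (fun p => k * G p) p = k * Dy G p := by
  unfold Dy
  rw [fderiv_const_mul (hG.diff p)]
  simp

/-- Theorem 2.1: there are absolute constants `γ⋆, δ⋆ > 0` such that no unidirectional
Stokes wave with `γ > γ⋆` and `r < γ + √(2/γ)` has
`min_x ψ_y(x, η(x)) = √(2γ) - δ⋆/γ`. -/
theorem no_critical_surface_minimum :
    ∃ γstar > (0 : ℝ), ∃ δstar > (0 : ℝ), ∀ γ > γstar,
      ∀ (ψ : ℝ → ℝ → ℝ) (η : ℝ → ℝ) (r Λ : ℝ),
        StokesWave γ ψ η r Λ → Unidirectional ψ η →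
        r < γ + Real.sqrt (2 / γ) →
        ¬ ((∀ x : ℝ, py ψ x (η x) ≥ Real.sqrt (2 * γ) - δstar / γ) ∧
           (∃ x₀ : ℝ, py ψ x₀ (η x₀) = Real.sqrt (2 * γ) - δstar / γ)) := by
  refine ⟨20000, by norm_num, 2, by norm_num, ?_⟩
  rintro γ hγ ψ η r Λ hS hU hr ⟨hge, x₀, hx₀⟩
  have hγ0 : 0 < γ := by linarith
  set k := Real.sqrt (2 / γ) with hk
  have hkpos : 0 < k := Real.sqrt_pos.2 (by positivity)
  have hk2 : k ^ 2 = 2 / γ := Real.sq_sqrt (by positivity)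
  have hγk : γ * k ^ 2 = 2 := by rw [hk2]; field_simp
  have hksmall : k ≤ 1 / 100 := by
    rw [hk, Real.sqrt_le_left (by norm_num), div_le_iff₀ hγ0]
    norm_num; linarith
  have hs2 : Real.sqrt (2 * γ) = 2 / k := by
    have e : 2 * γ = (2 / k) ^ 2 := by
      rw [div_pow, eq_div_iff (by positivity)]; linarith
    rw [e, Real.sqrt_sq (by positivity)]
  set F : ℝ × ℝ → ℝ := fun p => ψ p.1 p.2 with hF
  have hFs : Smooth F := hS.sol.psi_smooth
  have epx : ∀ x y, px ψ x y = Dx F (x, y) := fun x y => (hFs.hasx x y).deriv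
  have epy : ∀ x y, py ψ x y = Dy F (x, y) := fun x y => (hFs.hasy x y).deriv
  have epxx : ∀ x y, pxx ψ x y = Dx (Dx F) (x, y) := fun x y => by
    unfold pxx; simp only [epx]; exact (hFs.dx.hasx x y).deriv
  have epyy : ∀ x y, pyy ψ x y = Dy (Dy F) (x, y) := fun x y => by
    unfold pyy; simp only [epy]; exact (hFs.dy.hasy x y).deriv
  have hval : k * (Real.sqrt (2 * γ) - 2 / γ) = 2 - k ^ 3 := by
    rw [hs2, ← hk2]; field_simp
  -- choose the sign of the horizontal derivative
  obtain ⟨x₁, hx₁, hsgn⟩ : ∃ x₁, Dy F (x₁, η x₁) = Real.sqrt (2 * γ) - 2 / γ ∧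
      0 ≤ Dx F (x₁, η x₁) := by
    rw [epy] at hx₀
    rcases le_total 0 (Dx F (x₀, η x₀)) with h | h
    · exact ⟨x₀, hx₀, h⟩
    · refine ⟨-x₀, ?_, ?_⟩
      · rw [hS.eta_even, ← hx₀]
        have h1 := hFs.hasy (-x₀) (η x₀)
        simp only [hF, hS.psi_even] at h1
        exact h1.unique (hFs.hasy x₀ (η x₀))
      · rw [hS.eta_even]
        have h1 := hFs.curve (hasDerivAt_neg x₀) (hasDerivAt_const x₀ (η x₀))
        simp only [hF, hS.psi_even] at h1
        have h2 := h1.unique (hFs.hasx x₀ (η x₀))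
        simp only [← hF] at h2
        linarith
  have hηd : Differentiable ℝ η := hS.sol.eta_smooth.differentiable (by simp)
  have hkk : ∀ x : ℝ, k * (x / k) = x := fun x => by field_simp
  have dxe := scaleFn_dx k hFs
  have dye := scaleFn_dy k hFs
  have dxxe : ∀ p, Dx (Dx (scaleFn k F)) p = k ^ 2 * Dx (Dx F) (k * p.1, k * p.2) := by
    intro p
    rw [dxe, dx_const_mul k (scaleFn_smooth k hFs.dx), scaleFn_dx k hFs.dx]
    simp only [scaleFn]; ring
  have dyye : ∀ p, Dy (Dy (scaleFn k F)) p = k ^ 2 * Dy (Dy F) (k * p.1, k * p.2) := by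
    intro p
    rw [dye, dy_const_mul k (scaleFn_smooth k hFs.dy), scaleFn_dy k hFs.dy]
    simp only [scaleFn]; ring
  have hk3 : 0 < k ^ 3 := by positivity
  have main : Core (k ^ 3) ((2 * r * k ^ 2 - 4) / (2 * k ^ 3)) (2 * Λ / k) (x₁ / k)
      (scaleFn k F) (fun x => η (k * x) / k) := by
    refine
      { eps_pos := hk3
        eps_le := ?_
        mu_lt := ?_
        T_pos := div_pos (by linarith [hS.lam_pos]) hkpos
        f_smooth := scaleFn_smooth k hFs
        eta_diff := ?_
        eta_pos := fun x => div_pos (hS.sol.eta_pos _) hkpos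
        f_per := ?_
        eta_per := ?_
        lap := ?_
        bern := ?_
        top := ?_
        bot := ?_
        uni := ?_
        ge := ?_
        eq := ?_
        sgn := ?_ }
    · calc k ^ 3 ≤ (1 / 100) ^ 3 := pow_le_pow_left₀ hkpos.le hksmall 3
        _ ≤ 1 / 1000000 := by norm_num
    · rw [div_lt_one (by positivity)]
      have := mul_lt_mul_of_pos_right hr (by positivity : 0 < k ^ 2)
      nlinarith
    · exact (hηd.comp (differentiable_id.const_mul k)).div_const k
    · intro x y
      simp only [scaleFn, hF, mul_add, hkk, hS.psi_periodic]
    · intro x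
      simp only [mul_add, hkk, hS.eta_periodic]
    · rintro ⟨x, y⟩ ⟨h1, h2⟩
      simp only at h1 h2
      rw [dxxe, dyye, ← mul_add, ← epxx, ← epyy, hS.sol.laplace _ _ (by positivity)]
      · linarith
      · rw [lt_div_iff₀ hkpos] at h2; simp only; linarith
    · intro x
      have := hS.sol.bernoulli (k * x)
      rw [epx, epy] at this
      rw [dxe, dye]
      simp only [scaleFn, hkk]
      have e : 2 * k ^ 3 * ((2 * r * k ^ 2 - 4) / (2 * k ^ 3) - η (k * x) / k) =
          2 * r * k ^ 2 - 4 - 2 * k ^ 2 * η (k * x) := by field_simp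
      rw [e]
      linear_combination 2 * k ^ 2 * this
    · intro x
      simp only [scaleFn, hkk, hF, hS.sol.surface_val]
    · intro x
      simp only [scaleFn, hF, mul_zero, hS.sol.bottom_val]
    · intro x y h1 h2
      rw [dye]
      simp only [scaleFn]
      rw [← epy]
      refine mul_pos hkpos (hU _ _ (by positivity) ?_)
      rw [lt_div_iff₀ hkpos] at h2; linarith
    · intro x
      rw [dye, ← hval]
      simp only [scaleFn, hkk]
      rw [← epy]
      exact mul_le_mul_of_nonneg_left (hge _) hkpos.le
    · rw [dye, ← hval]
      simp only [scaleFn, hkk]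
      rw [hx₁]
    · rw [dxe]
      simp only [scaleFn, hkk]
      exact mul_nonneg hkpos.le hsgn
  exact main.false
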